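/- Consider the semidefinite game with m = n = 2 in which both players' payoff is p(X,Y) = X_{11}Y_{11} + X_{22}Y_{22} + 4c·X_{12}Y_{12}, i.e., Φ_A(Y) = Φ'_B(Y) = [[Y_{11}, 2cY_{12}],[2cY_{12}, Y_{22}]], with a constant c > 1/2. Then each of the five pairs X = Y = [[1,0],[0,0]]; X = Y = [[0,0],[0,1]]; X = Y = [[1/2,0],[0,1/2]]; X = Y = [[1/2,1/2],[1/2,1/2]]; and X = Y = [[1/2,−1/2],[−1/2,1/2]] is a Nash equilibrium, and each of them satisfies strict complementarity: rank X + rank(λ_max(Φ_A(Y))·I_2 − Φ_A(Y)) = 2 and rank Y + rank(λ_max(Φ'_B(X))·I_2 − Φ'_B(X)) = 2. -/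

import Mathlib

open Matrix BigOperators

noncomputable section

/-- Frobenius inner product of two square matrices. -/
def frob {p : ℕ} (M N : Matrix (Fin p) (Fin p) ℝ) : ℝ := ∑ i, ∑ j, M i j * N i j

/-- Strategy space: symmetric (Hermitian) positive semidefinite matrices of trace one. -/
def Strat (p : ℕ) : Set (Matrix (Fin p) (Fin p) ℝ) :=
  {X | X.PosSemidef ∧ X.trace = 1}

/-- The payoff matrix `Φ_A(Y) = Φ'_B(Y) = [[Y₁₁, 2cY₁₂],[2cY₁₂, Y₂₂]]` of the game with
payoff `p(X,Y) = X₁₁Y₁₁ + X₂₂Y₂₂ + 4c·X₁₂Y₁₂`. -/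
def Phi (c : ℝ) (Y : Matrix (Fin 2) (Fin 2) ℝ) : Matrix (Fin 2) (Fin 2) ℝ :=
  !![Y 0 0, 2 * c * Y 0 1; 2 * c * Y 0 1, Y 1 1]

/-- The largest eigenvalue of a (symmetric) real matrix. -/
def lamMax {p : ℕ} (M : Matrix (Fin p) (Fin p) ℝ) : ℝ :=
  sSup {e : ℝ | ∃ v : Fin p → ℝ, v ≠ 0 ∧ M.mulVec v = e • v}

/-- `(M, M)` is a Nash equilibrium of the symmetric semidefinite game with payoff
operator `Φ c`, and it satisfies strict complementarity. -/
def IsNEStrictComp (c : ℝ) (M : Matrix (Fin 2) (Fin 2) ℝ) : Prop :=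
  M ∈ Strat 2 ∧
  (∀ X' ∈ Strat 2, frob X' (Phi c M) ≤ frob M (Phi c M)) ∧
  (∀ Y' ∈ Strat 2, frob (Phi c M) Y' ≤ frob (Phi c M) M) ∧
  M.rank + (lamMax (Phi c M) • (1 : Matrix (Fin 2) (Fin 2) ℝ) - Phi c M).rank = 2

theorem frob_comm {p : ℕ} (M N : Matrix (Fin p) (Fin p) ℝ) : frob M N = frob N M := by
  simp only [frob, mul_comm]

/-- Entrywise description of the strategies of size two. -/
theorem entries_of_mem_strat_two {X : Matrix (Fin 2) (Fin 2) ℝ} (hX : X ∈ Strat 2) :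
    X 1 0 = X 0 1 ∧ X 0 1 ^ 2 ≤ X 0 0 * X 1 1 ∧ 0 ≤ X 0 0 ∧ 0 ≤ X 1 1 ∧
      X 0 0 + X 1 1 = 1 := by
  obtain ⟨hpos, htr⟩ := hX
  have hsymm : X 1 0 = X 0 1 := by simpa using hpos.1.apply 0 1
  have hdet := hpos.det_nonneg
  rw [det_fin_two, hsymm] at hdet
  rw [trace_fin_two] at htr
  exact ⟨hsymm, by linarith [sq (X 0 1)], hpos.diag_nonneg, hpos.diag_nonneg, htr⟩

/-- A symmetric matrix with nonnegative quadratic form and trace one is a strategy. -/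
theorem mem_strat_two {a b d : ℝ} (h : ∀ x y : ℝ, 0 ≤ a * x ^ 2 + 2 * b * x * y + d * y ^ 2)
    (htr : a + d = 1) : !![a, b; b, d] ∈ Strat 2 := by
  refine ⟨PosSemidef.of_dotProduct_mulVec_nonneg ?_ fun v => ?_, by simpa [trace_fin_two]⟩
  · ext i j
    fin_cases i <;> fin_cases j <;> simp
  · have := h (v 0) (v 1)
    simp only [dotProduct, mulVec, Fin.sum_univ_two, Pi.star_apply, star_trivial, of_apply,
      cons_val_zero, cons_val_one, cons_val', cons_val_fin_one]
    linarith

/-- An eigenvalue that bounds the quadratic form is the largest eigenvalue. -/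
theorem lamMax_eq {p : ℕ} {M : Matrix (Fin p) (Fin p) ℝ} {l : ℝ} {v : Fin p → ℝ} (hv : v ≠ 0)
    (hMv : M *ᵥ v = l • v) (h : ∀ w : Fin p → ℝ, w ⬝ᵥ M *ᵥ w ≤ l * (w ⬝ᵥ w)) :
    lamMax M = l := by
  refine IsGreatest.csSup_eq ⟨⟨v, hv, hMv⟩, ?_⟩
  rintro e ⟨w, hw, hMw⟩
  have hle := h w
  rw [hMw, dotProduct_smul, smul_eq_mul] at hle
  have hpos : 0 < w ⬝ᵥ w := by
    simpa using dotProduct_star_self_pos_iff.mpr hw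
  exact le_of_mul_le_mul_right hle hpos

theorem lamMax_fin_two_eq {a b d l x y : ℝ} (hxy : x ≠ 0 ∨ y ≠ 0) (hx : a * x + b * y = l * x)
    (hy : b * x + d * y = l * y)
    (h : ∀ s t : ℝ, a * s ^ 2 + 2 * b * s * t + d * t ^ 2 ≤ l * (s ^ 2 + t ^ 2)) :
    lamMax !![a, b; b, d] = l := by
  refine lamMax_eq (v := ![x, y]) (fun h0 => ?_) ?_ fun w => ?_
  · have h1 := congrFun h0 0
    have h2 := congrFun h0 1
    simp only [cons_val_zero, cons_val_one, Pi.zero_apply, cons_val_fin_one] at h1 h2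
    tauto
  · ext i
    fin_cases i <;> simpa [mulVec, dotProduct, Fin.sum_univ_two]
  · have := h (w 0) (w 1)
    simp only [dotProduct, mulVec, Fin.sum_univ_two, of_apply,
      cons_val_zero, cons_val_one, cons_val', cons_val_fin_one]
    linarith

theorem rank_fin_two_eq_one {k x y : ℝ} (hk : k ≠ 0) (hxy : x ≠ 0 ∨ y ≠ 0) :
    (!![k * x * x, k * x * y; k * x * y, k * y * y] : Matrix (Fin 2) (Fin 2) ℝ).rank = 1 := by
  have heq : (!![k * x * x, k * x * y; k * x * y, k * y * y] : Matrix (Fin 2) (Fin 2) ℝ) =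
      vecMulVec ![k * x, k * y] ![x, y] := by
    ext i j
    fin_cases i <;> fin_cases j <;> simp [vecMulVec_apply]; ring
  refine le_antisymm (heq ▸ rank_vecMulVec_le _ _) (Nat.one_le_iff_ne_zero.mpr fun h0 => ?_)
  rw [rank, Submodule.finrank_eq_zero, LinearMap.range_eq_bot, ← toLin'_apply',
    LinearEquiv.map_eq_zero_iff] at h0
  have h1 := congrFun (congrFun h0 0) 0
  have h2 := congrFun (congrFun h0 1) 1
  simp [hk] at h1 h2
  tauto

/-- A strategy `M` at which the payoff matrix of `M` attains its largest eigenvalue, with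
complementary rank, is a strictly complementary Nash equilibrium. -/
theorem isNEStrictComp_of_lamMax {c l : ℝ} {M : Matrix (Fin 2) (Fin 2) ℝ} (hM : M ∈ Strat 2)
    (hval : frob M (Phi c M) = l) (hmax : ∀ X ∈ Strat 2, frob X (Phi c M) ≤ l)
    (hlam : lamMax (Phi c M) = l)
    (hrank : M.rank + (l • (1 : Matrix (Fin 2) (Fin 2) ℝ) - Phi c M).rank = 2) :
    IsNEStrictComp c M := by
  refine ⟨hM, fun X hX => hval ▸ hmax X hX, fun X hX => ?_, hlam ▸ hrank⟩
  rw [frob_comm _ X, frob_comm _ M, hval]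
  exact hmax X hX

theorem abs_two_mul_le_one_of_mem_strat {X : Matrix (Fin 2) (Fin 2) ℝ} (hX : X ∈ Strat 2) :
    |2 * X 0 1| ≤ 1 := by
  obtain ⟨-, hdet, -, -, htr⟩ := entries_of_mem_strat_two hX
  rw [← sq_le_one_iff_abs_le_one]
  nlinarith [sq_nonneg (X 0 0 - X 1 1)]

theorem isNEStrictComp_left (c : ℝ) : IsNEStrictComp c !![1, 0; 0, 0] := by
  have hPhi : Phi c !![1, 0; 0, 0] = !![1, 0; 0, 0] := by simp [Phi]
  refine isNEStrictComp_of_lamMax (l := 1) (mem_strat_two (fun x y => ?_) (by norm_num)) ?_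
    (fun X hX => ?_) ?_ ?_
  · nlinarith [sq_nonneg x]
  · rw [hPhi]
    simp [frob]
  · obtain ⟨-, -, h0, h1, htr⟩ := entries_of_mem_strat_two hX
    rw [hPhi]
    simp [frob]
    linarith
  · rw [hPhi]
    exact lamMax_fin_two_eq (x := 1) (y := 0) (by simp) (by simp) (by simp)
      fun s t => by nlinarith [sq_nonneg t]
  · rw [hPhi]
    have h1 := rank_fin_two_eq_one (k := 1) (x := 1) (y := 0) (by simp) (by simp)
    have h2 := rank_fin_two_eq_one (k := 1) (x := 0) (y := 1) (by simp) (by simp)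
    simp only [mul_one, mul_zero] at h1 h2
    rw [h1, show (1 : ℝ) • (1 : Matrix (Fin 2) (Fin 2) ℝ) - !![1, 0; 0, 0] = !![0, 0; 0, 1] by
      ext i j; fin_cases i <;> fin_cases j <;> simp, h2]

theorem isNEStrictComp_right (c : ℝ) : IsNEStrictComp c !![0, 0; 0, 1] := by
  have hPhi : Phi c !![0, 0; 0, 1] = !![0, 0; 0, 1] := by simp [Phi]
  refine isNEStrictComp_of_lamMax (l := 1) (mem_strat_two (fun x y => ?_) (by norm_num)) ?_
    (fun X hX => ?_) ?_ ?_
  · nlinarith [sq_nonneg y]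
  · rw [hPhi]
    simp [frob]
  · obtain ⟨-, -, h0, h1, htr⟩ := entries_of_mem_strat_two hX
    rw [hPhi]
    simp [frob]
    linarith
  · rw [hPhi]
    exact lamMax_fin_two_eq (x := 0) (y := 1) (by simp) (by simp) (by simp)
      fun s t => by nlinarith [sq_nonneg s]
  · rw [hPhi]
    have h1 := rank_fin_two_eq_one (k := 1) (x := 1) (y := 0) (by simp) (by simp)
    have h2 := rank_fin_two_eq_one (k := 1) (x := 0) (y := 1) (by simp) (by simp)
    simp only [mul_one, mul_zero] at h1 h2
    rw [h2, show (1 : ℝ) • (1 : Matrix (Fin 2) (Fin 2) ℝ) - !![0, 0; 0, 1] = !![1, 0; 0, 0] by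
      ext i j; fin_cases i <;> fin_cases j <;> simp, h1]

theorem isNEStrictComp_uniform (c : ℝ) : IsNEStrictComp c !![1/2, 0; 0, 1/2] := by
  have hPhi : Phi c !![1/2, 0; 0, 1/2] = !![1/2, 0; 0, 1/2] := by simp [Phi]
  have hscalar : (!![1/2, 0; 0, 1/2] : Matrix (Fin 2) (Fin 2) ℝ) = (1/2 : ℝ) • 1 := by
    ext i j; fin_cases i <;> fin_cases j <;> simp
  refine isNEStrictComp_of_lamMax (l := 1/2) (mem_strat_two (fun x y => ?_) (by norm_num)) ?_
    (fun X hX => ?_) ?_ ?_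
  · nlinarith [sq_nonneg x, sq_nonneg y]
  · rw [hPhi]
    simp [frob]
    norm_num
  · obtain ⟨-, -, h0, h1, htr⟩ := entries_of_mem_strat_two hX
    rw [hPhi]
    simp [frob]
    linarith
  · rw [hPhi]
    exact lamMax_fin_two_eq (x := 1) (y := 0) (by simp) (by simp) (by simp)
      fun s t => by nlinarith
  · rw [hPhi, ← hscalar, sub_self, rank_zero, add_zero]
    refine (rank_of_isUnit _ ?_).trans (Fintype.card_fin 2)
    rw [isUnit_iff_isUnit_det, det_fin_two_of]
    norm_num

theorem isNEStrictComp_of_sign {c : ℝ} (hc : 1 / 2 < c) {b : ℝ} (hb : b = 1/2 ∨ b = -(1/2)) :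
    IsNEStrictComp c !![1/2, b; b, 1/2] := by
  have hb2 : b * b = 1/4 := by rcases hb with rfl | rfl <;> norm_num
  have hPhi : Phi c !![1/2, b; b, 1/2] = !![1/2, 2 * c * b; 2 * c * b, 1/2] := by simp [Phi]
  refine isNEStrictComp_of_lamMax (l := 1/2 + c) (mem_strat_two (fun x y => ?_) (by norm_num)) ?_
    (fun X hX => ?_) ?_ ?_
  · rcases hb with rfl | rfl
    · nlinarith [sq_nonneg (x + y)]
    · nlinarith [sq_nonneg (x - y)]
  · rw [hPhi]
    simp [frob]
    linear_combination 4 * c * hb2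
  · obtain ⟨hs, -, -, -, htr⟩ := entries_of_mem_strat_two hX
    obtain ⟨h1, h2⟩ := abs_le.mp (abs_two_mul_le_one_of_mem_strat hX)
    rw [hPhi]
    simp [frob, hs]
    rcases hb with rfl | rfl <;> nlinarith
  · rw [hPhi]
    refine lamMax_fin_two_eq (x := 1) (y := 2 * b) (by simp) ?_ ?_ fun s t => ?_
    · linear_combination 4 * c * hb2
    · ring
    · rcases hb with rfl | rfl
      · nlinarith [mul_nonneg (show 0 ≤ c by linarith) (sq_nonneg (s - t))]
      · nlinarith [mul_nonneg (show 0 ≤ c by linarith) (sq_nonneg (s + t))]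
  · have h1 := rank_fin_two_eq_one (k := 1/2) (x := 1) (y := 2 * b) (by norm_num) (by simp)
    have h2 := rank_fin_two_eq_one (k := c) (x := 1) (y := -(2 * b)) (by linarith) (by simp)
    rw [hPhi]
    convert congrArg₂ (· + ·) h1 h2 using 3
    · ext i j
      fin_cases i <;> fin_cases j <;> simp
      linear_combination -2 * hb2
    · ext i j
      fin_cases i <;> fin_cases j <;> simp <;> first | linear_combination -4 * c * hb2 | ring

/-- The five symmetric strategy pairs are Nash equilibria of the game with payoff
`p(X,Y) = X₁₁Y₁₁ + X₂₂Y₂₂ + 4c·X₁₂Y₁₂`, `c > 1/2`, and all satisfy strict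
complementarity. -/
theorem five_nash_equilibria_strict_complementary (c : ℝ) (hc : 1 / 2 < c) :
    ∀ M ∈ ({!![1, 0; 0, 0], !![0, 0; 0, 1], !![1/2, 0; 0, 1/2],
            !![1/2, 1/2; 1/2, 1/2], !![1/2, -(1/2); -(1/2), 1/2]} :
            Set (Matrix (Fin 2) (Fin 2) ℝ)),
      IsNEStrictComp c M := by
  rintro M (rfl | rfl | rfl | rfl | rfl)
  · exact isNEStrictComp_left c
  · exact isNEStrictComp_right c
  · exact isNEStrictComp_uniform c
  · exact isNEStrictComp_of_sign hc (.inl rfl)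
  · exact isNEStrictComp_of_sign hc (.inr rfl)
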